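/- Let U′, U″, U‴ be unitary matrices of sizes n′×n′, n″×n″, n‴×n‴, let V be a unitary p×p matrix and V′ a unitary p′×p′ matrix, with p ≤ n′, p ≤ n″, p′ ≤ n″, p′ ≤ n‴ and p + p′ ≤ n″ (so that in U″ the first p channels are glued via V to the last p channels of U′, and the last p′ channels of U″ are glued via V′ to the first p′ channels of U‴). If Condition A is satisfied for each of the compositions U′ *_V U″, U″ *_{V′} U‴, U′ *_V (U″ *_{V′} U‴) and (U′ *_V U″) *_{V′} U‴, then the generalized star product is associative: U′ *_V (U″ *_{V′} U‴) = (U′ *_V U″) *_{V′} U‴. -/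

import Mathlib

open Matrix

noncomputable section

/-- Condition A for the generalized star product: `1` is not an eigenvalue of
`V·U′₂₂·V⁻¹·U″₁₁`. -/
def CondA {α β γ : Type*} [Fintype α] [Fintype β] [Fintype γ] [DecidableEq γ]
    (U' : Matrix (α ⊕ γ) (α ⊕ γ) ℂ) (U'' : Matrix (γ ⊕ β) (γ ⊕ β) ℂ)
    (V : Matrix γ γ ℂ) : Prop :=
  ¬ Module.End.HasEigenvalue
      (Matrix.mulVecLin (V * U'.toBlocks₂₂ * V⁻¹ * U''.toBlocks₁₁)) 1

/-- The generalized star product `U = U′ *_V U″`: the last `p` channels of `U′` are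
glued to the first `p` channels of `U″` through the unitary `V`. -/
noncomputable def starProd {α β γ : Type*} [Fintype α] [Fintype β] [Fintype γ]
    [DecidableEq γ]
    (U' : Matrix (α ⊕ γ) (α ⊕ γ) ℂ) (U'' : Matrix (γ ⊕ β) (γ ⊕ β) ℂ)
    (V : Matrix γ γ ℂ) : Matrix (α ⊕ β) (α ⊕ β) ℂ :=
  let K₁ : Matrix γ γ ℂ := (1 - V * U'.toBlocks₂₂ * V⁻¹ * U''.toBlocks₁₁)⁻¹ * V
  let K₂ : Matrix γ γ ℂ := (1 - V⁻¹ * U''.toBlocks₁₁ * V * U'.toBlocks₂₂)⁻¹ * V⁻¹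
  Matrix.fromBlocks
    (U'.toBlocks₁₁ + U'.toBlocks₁₂ * K₂ * U''.toBlocks₁₁ * V * U'.toBlocks₂₁)
    (U'.toBlocks₁₂ * K₂ * U''.toBlocks₁₂)
    (U''.toBlocks₂₁ * K₁ * U'.toBlocks₂₁)
    (U''.toBlocks₂₂ + U''.toBlocks₂₁ * K₁ * U'.toBlocks₂₂ * V⁻¹ * U''.toBlocks₁₂)

lemma CondA.isUnit_det {α β γ : Type*} [Fintype α] [Fintype β] [Fintype γ] [DecidableEq γ]
    {U' : Matrix (α ⊕ γ) (α ⊕ γ) ℂ} {U'' : Matrix (γ ⊕ β) (γ ⊕ β) ℂ} {V : Matrix γ γ ℂ}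
    (h : CondA U' U'' V) :
    IsUnit (1 - V * U'.toBlocks₂₂ * V⁻¹ * U''.toBlocks₁₁).det := by
  rw [isUnit_iff_ne_zero]
  intro h0
  obtain ⟨v, hv, hv0⟩ := Matrix.exists_mulVec_eq_zero_iff.mpr h0
  rw [Matrix.sub_mulVec, Matrix.one_mulVec, sub_eq_zero] at hv0
  refine h (Module.End.hasEigenvalue_of_hasEigenvector (x := v) ⟨?_, hv⟩)
  rw [Module.End.mem_eigenspace_iff, Matrix.mulVecLin_apply, one_smul, ← hv0]

lemma CondA.isUnit_det' {α β γ : Type*} [Fintype α] [Fintype β] [Fintype γ] [DecidableEq γ]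
    {U' : Matrix (α ⊕ γ) (α ⊕ γ) ℂ} {U'' : Matrix (γ ⊕ β) (γ ⊕ β) ℂ} {V : Matrix γ γ ℂ}
    (h : CondA U' U'' V) :
    IsUnit (1 - V⁻¹ * U''.toBlocks₁₁ * V * U'.toBlocks₂₂).det := by
  have := h.isUnit_det
  rwa [Matrix.mul_assoc (V * _), Matrix.det_one_sub_mul_comm, ← Matrix.mul_assoc] at this

lemma Matrix.eq_nonsing_inv_mulVec_iff {n : Type*} [Fintype n] [DecidableEq n]
    {A : Matrix n n ℂ} (hA : IsUnit A.det) {x y : n → ℂ} :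
    x = A⁻¹ *ᵥ y ↔ A *ᵥ x = y := by
  constructor
  · rintro rfl
    rw [Matrix.mulVec_mulVec, Matrix.mul_nonsing_inv _ hA, Matrix.one_mulVec]
  · rintro rfl
    rw [Matrix.mulVec_mulVec, Matrix.nonsing_inv_mul _ hA, Matrix.one_mulVec]

lemma Matrix.eq_of_mulVec_eq_imp {m n : Type*} [Fintype n] [DecidableEq n] {M N : Matrix m n ℂ}
    (h : ∀ (v : n → ℂ) (w : m → ℂ), M *ᵥ v = w → N *ᵥ v = w) : M = N :=
  Matrix.ext_of_mulVec_single fun i => (h (Pi.single i 1) _ rfl).symm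

lemma Matrix.mulVec_sumElim_eq_iff {l m n o : Type*} [Fintype l] [Fintype m]
    (M : Matrix (n ⊕ o) (l ⊕ m) ℂ) (x : l → ℂ) (y : m → ℂ) (x' : n → ℂ) (y' : o → ℂ) :
    M *ᵥ Sum.elim x y = Sum.elim x' y' ↔
      M.toBlocks₁₁ *ᵥ x + M.toBlocks₁₂ *ᵥ y = x' ∧
        M.toBlocks₂₁ *ᵥ x + M.toBlocks₂₂ *ᵥ y = y' := by
  conv_lhs => rw [← Matrix.fromBlocks_toBlocks M, Matrix.fromBlocks_mulVec]
  simp [Sum.elim_eq_iff]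

lemma Matrix.reindex_mulVec_eq_iff {m n : Type*} [Fintype m] [Fintype n]
    (e : m ≃ n) (M : Matrix m m ℂ) (x y : n → ℂ) :
    Matrix.reindex e e M *ᵥ x = y ↔ M *ᵥ (x ∘ e) = y ∘ e := by
  rw [Matrix.reindex_apply, Matrix.submatrix_mulVec_equiv, Equiv.symm_symm,
    Equiv.comp_symm_eq]

/-- The star product is the input-output relation obtained by eliminating the amplitudes on the
glued channels. -/
lemma starProd_mulVec_eq_iff {α β γ : Type*} [Fintype α] [Fintype β] [Fintype γ] [DecidableEq γ]
    {U' : Matrix (α ⊕ γ) (α ⊕ γ) ℂ} {U'' : Matrix (γ ⊕ β) (γ ⊕ β) ℂ} {V : Matrix γ γ ℂ}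
    (hV : IsUnit V.det) (h : CondA U' U'' V) (x x' : α → ℂ) (y y' : β → ℂ) :
    starProd U' U'' V *ᵥ Sum.elim x y = Sum.elim x' y' ↔
      ∃ u u' : γ → ℂ, U' *ᵥ Sum.elim x u = Sum.elim x' u' ∧
        U'' *ᵥ Sum.elim (V *ᵥ u') y = Sum.elim (V *ᵥ u) y' := by
  have hW : V * V⁻¹ = 1 := Matrix.mul_nonsing_inv V hV
  have hW' : V⁻¹ * V = 1 := Matrix.nonsing_inv_mul V hV
  have hN₁ := h.isUnit_det
  have hN₂ := h.isUnit_det'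
  simp only [Matrix.mulVec_sumElim_eq_iff, starProd, Matrix.toBlocks_fromBlocks₁₁,
    Matrix.toBlocks_fromBlocks₁₂, Matrix.toBlocks_fromBlocks₂₁, Matrix.toBlocks_fromBlocks₂₂]
  generalize U'.toBlocks₁₁ = a₁₁ at *
  generalize U'.toBlocks₁₂ = a₁₂ at *
  generalize U'.toBlocks₂₁ = a₂₁ at *
  generalize U'.toBlocks₂₂ = a₂₂ at *
  generalize U''.toBlocks₁₁ = b₁₁ at *
  generalize U''.toBlocks₁₂ = b₁₂ at *
  generalize U''.toBlocks₂₁ = b₂₁ at *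
  generalize U''.toBlocks₂₂ = b₂₂ at *
  have cancel (z : γ → ℂ) : V *ᵥ V⁻¹ *ᵥ z = z := by
    rw [Matrix.mulVec_mulVec, hW, Matrix.one_mulVec]
  have cancel' (z : γ → ℂ) : V⁻¹ *ᵥ V *ᵥ z = z := by
    rw [Matrix.mulVec_mulVec, hW', Matrix.one_mulVec]
  -- the glued amplitudes, in terms of the external ones
  have solve_u {u u' : γ → ℂ} (h₁ : a₂₁ *ᵥ x + a₂₂ *ᵥ u = u')
      (h₂ : b₁₁ *ᵥ V *ᵥ u' + b₁₂ *ᵥ y = V *ᵥ u) :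
      u = (1 - V⁻¹ * b₁₁ * V * a₂₂)⁻¹ *ᵥ V⁻¹ *ᵥ (b₁₁ *ᵥ V *ᵥ a₂₁ *ᵥ x + b₁₂ *ᵥ y) := by
    rw [Matrix.eq_nonsing_inv_mulVec_iff hN₂]
    have h₃ := congrArg (V⁻¹ *ᵥ ·) h₂
    simp only [cancel', ← h₁, Matrix.mulVec_add] at h₃
    simp only [Matrix.sub_mulVec, Matrix.one_mulVec, ← Matrix.mulVec_mulVec, Matrix.mulVec_add]
    nth_rewrite 1 [← h₃]
    abel
  have solve_w {u u' : γ → ℂ} (h₁ : a₂₁ *ᵥ x + a₂₂ *ᵥ u = u')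
      (h₂ : b₁₁ *ᵥ V *ᵥ u' + b₁₂ *ᵥ y = V *ᵥ u) :
      V *ᵥ u' = (1 - V * a₂₂ * V⁻¹ * b₁₁)⁻¹ *ᵥ V *ᵥ (a₂₁ *ᵥ x + a₂₂ *ᵥ V⁻¹ *ᵥ b₁₂ *ᵥ y) := by
    rw [Matrix.eq_nonsing_inv_mulVec_iff hN₁]
    have h₃ := congrArg (V⁻¹ *ᵥ ·) h₂
    simp only [cancel', Matrix.mulVec_add] at h₃
    have h₄ : u' = a₂₁ *ᵥ x + a₂₂ *ᵥ (V⁻¹ *ᵥ b₁₁ *ᵥ V *ᵥ u' + V⁻¹ *ᵥ b₁₂ *ᵥ y) := by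
      rw [h₃, h₁]
    have h₅ := congrArg (V *ᵥ ·) h₄
    simp only [Matrix.mulVec_add] at h₅
    simp only [Matrix.sub_mulVec, Matrix.one_mulVec, ← Matrix.mulVec_mulVec, Matrix.mulVec_add]
    nth_rewrite 1 [h₅]
    abel
  have output {u u' : γ → ℂ} (h₁ : a₂₁ *ᵥ x + a₂₂ *ᵥ u = u')
      (h₂ : b₁₁ *ᵥ V *ᵥ u' + b₁₂ *ᵥ y = V *ᵥ u) :
      (a₁₁ + a₁₂ * ((1 - V⁻¹ * b₁₁ * V * a₂₂)⁻¹ * V⁻¹) * b₁₁ * V * a₂₁) *ᵥ x +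
          (a₁₂ * ((1 - V⁻¹ * b₁₁ * V * a₂₂)⁻¹ * V⁻¹) * b₁₂) *ᵥ y = a₁₁ *ᵥ x + a₁₂ *ᵥ u ∧
        (b₂₁ * ((1 - V * a₂₂ * V⁻¹ * b₁₁)⁻¹ * V) * a₂₁) *ᵥ x +
          (b₂₂ + b₂₁ * ((1 - V * a₂₂ * V⁻¹ * b₁₁)⁻¹ * V) * a₂₂ * V⁻¹ * b₁₂) *ᵥ y =
          b₂₁ *ᵥ V *ᵥ u' + b₂₂ *ᵥ y := by
    rw [solve_w h₁ h₂]
    nth_rewrite 1 [solve_u h₁ h₂]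
    simp only [Matrix.add_mulVec, ← Matrix.mulVec_mulVec, Matrix.mulVec_add]
    constructor <;> abel
  constructor
  · rintro ⟨rfl, rfl⟩
    obtain ⟨u, hu⟩ : ∃ u : γ → ℂ,
        u = (1 - V⁻¹ * b₁₁ * V * a₂₂)⁻¹ *ᵥ V⁻¹ *ᵥ (b₁₁ *ᵥ V *ᵥ a₂₁ *ᵥ x + b₁₂ *ᵥ y) := ⟨_, rfl⟩
    have h₂ : b₁₁ *ᵥ V *ᵥ (a₂₁ *ᵥ x + a₂₂ *ᵥ u) + b₁₂ *ᵥ y = V *ᵥ u := by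
      rw [Matrix.eq_nonsing_inv_mulVec_iff hN₂] at hu
      have h₃ := congrArg (V *ᵥ ·) hu
      simp only [Matrix.sub_mulVec, Matrix.one_mulVec, ← Matrix.mulVec_mulVec, Matrix.mulVec_sub,
        cancel] at h₃
      rw [sub_eq_iff_eq_add] at h₃
      rw [h₃]
      simp only [Matrix.mulVec_add]
      abel
    obtain ⟨h₃, h₄⟩ := output rfl h₂
    exact ⟨u, _, ⟨h₃.symm, rfl⟩, h₂, h₄.symm⟩
  · rintro ⟨u, u', ⟨rfl, h₁⟩, h₂, rfl⟩
    exact output h₁ h₂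

lemma sumElim_comp_sumAssoc {α β γ : Type*} (x : α → ℂ) (y : β → ℂ) (z : γ → ℂ) :
    Sum.elim x (Sum.elim y z) ∘ Equiv.sumAssoc α β γ = Sum.elim (Sum.elim x y) z := by
  ext ((i | i) | i) <;> rfl

lemma sumElim_comp_sumAssoc_symm {α β γ : Type*} (x : α → ℂ) (y : β → ℂ) (z : γ → ℂ) :
    Sum.elim (Sum.elim x y) z ∘ (Equiv.sumAssoc α β γ).symm = Sum.elim x (Sum.elim y z) := by
  ext (i | i | i) <;> rfl

lemma Matrix.UnitaryGroup.isUnit_det {n : Type*} [Fintype n] [DecidableEq n]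
    {A : Matrix n n ℂ} (hA : A ∈ Matrix.unitaryGroup n ℂ) : IsUnit A.det :=
  (Matrix.isUnit_iff_isUnit_det A).mp
    (IsUnit.of_mul_eq_one _ (Matrix.mem_unitaryGroup_iff.mp hA))

/-- Associativity of the generalized star product. Here `U″` carries the channel
structure `γ ⊕ (δ ⊕ γ′)`: its first `p` channels (type `γ`) are glued via `V` to the
last `p` channels of `U′`, and its last `p′` channels (type `γ′`) are glued via `V′`
to the first `p′` channels of `U‴`; the reindexings by `Equiv.sumAssoc` keep the order
of the remaining channels fixed. -/
theorem starProd_assoc {α δ β γ γ' : Type*}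
    [Fintype α] [Fintype δ] [Fintype β] [Fintype γ] [Fintype γ']
    [DecidableEq α] [DecidableEq δ] [DecidableEq β] [DecidableEq γ] [DecidableEq γ']
    (U' : Matrix (α ⊕ γ) (α ⊕ γ) ℂ)
    (U'' : Matrix (γ ⊕ (δ ⊕ γ')) (γ ⊕ (δ ⊕ γ')) ℂ)
    (U''' : Matrix (γ' ⊕ β) (γ' ⊕ β) ℂ)
    (V : Matrix γ γ ℂ) (V' : Matrix γ' γ' ℂ)
    (hU' : U' ∈ Matrix.unitaryGroup (α ⊕ γ) ℂ)
    (hU'' : U'' ∈ Matrix.unitaryGroup (γ ⊕ (δ ⊕ γ')) ℂ)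
    (hU''' : U''' ∈ Matrix.unitaryGroup (γ' ⊕ β) ℂ)
    (hV : V ∈ Matrix.unitaryGroup γ ℂ)
    (hV' : V' ∈ Matrix.unitaryGroup γ' ℂ)
    (h1 : CondA U' U'' V)
    (h2 : CondA
      (Matrix.reindex (Equiv.sumAssoc γ δ γ').symm (Equiv.sumAssoc γ δ γ').symm U'')
      U''' V')
    (h3 : CondA U'
      (Matrix.reindex (Equiv.sumAssoc γ δ β) (Equiv.sumAssoc γ δ β)
        (starProd
          (Matrix.reindex (Equiv.sumAssoc γ δ γ').symm (Equiv.sumAssoc γ δ γ').symm U'')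
          U''' V'))
      V)
    (h4 : CondA
      (Matrix.reindex (Equiv.sumAssoc α δ γ').symm (Equiv.sumAssoc α δ γ').symm
        (starProd U' U'' V))
      U''' V') :
    starProd U'
      (Matrix.reindex (Equiv.sumAssoc γ δ β) (Equiv.sumAssoc γ δ β)
        (starProd
          (Matrix.reindex (Equiv.sumAssoc γ δ γ').symm (Equiv.sumAssoc γ δ γ').symm U'')
          U''' V'))
      V =
    Matrix.reindex (Equiv.sumAssoc α δ β) (Equiv.sumAssoc α δ β)
      (starProd
        (Matrix.reindex (Equiv.sumAssoc α δ γ').symm (Equiv.sumAssoc α δ γ').symm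
          (starProd U' U'' V))
        U''' V') := by
  have hV := Matrix.UnitaryGroup.isUnit_det hV
  have hV' := Matrix.UnitaryGroup.isUnit_det hV'
  refine Matrix.eq_of_mulVec_eq_imp fun v v' hv' => ?_
  obtain ⟨x, d, y, rfl⟩ : ∃ x d y, v = Sum.elim x (Sum.elim d y) :=
    ⟨_, _, _, by rw [Sum.elim_comp_inl_inr (v ∘ Sum.inr), Sum.elim_comp_inl_inr]⟩
  obtain ⟨x', d', y', rfl⟩ : ∃ x d y, v' = Sum.elim x (Sum.elim d y) :=
    ⟨_, _, _, by rw [Sum.elim_comp_inl_inr (v' ∘ Sum.inr), Sum.elim_comp_inl_inr]⟩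
  rw [starProd_mulVec_eq_iff hV h3] at hv'
  obtain ⟨u, u', hu, hu'⟩ := hv'
  rw [Matrix.reindex_mulVec_eq_iff, sumElim_comp_sumAssoc, sumElim_comp_sumAssoc,
    starProd_mulVec_eq_iff hV' h2] at hu'
  obtain ⟨w, w', hw, hw'⟩ := hu'
  rw [Matrix.reindex_mulVec_eq_iff, sumElim_comp_sumAssoc_symm, sumElim_comp_sumAssoc_symm] at hw
  rw [Matrix.reindex_mulVec_eq_iff, sumElim_comp_sumAssoc, sumElim_comp_sumAssoc,
    starProd_mulVec_eq_iff hV' h4]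
  refine ⟨w, w', ?_, hw'⟩
  rw [Matrix.reindex_mulVec_eq_iff, sumElim_comp_sumAssoc_symm, sumElim_comp_sumAssoc_symm,
    starProd_mulVec_eq_iff hV h1]
  exact ⟨u, u', hu, hw⟩
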